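/- There exist universal constants c, c' > 0 with the following property. Let δ ∈ (0,1) and d ∈ ℕ. There exists an estimator t̂_mix : Ω^m → ℝ such that for every ergodic Markov chain X₁, …, X_m ~ (μ, M) on Ω with |Ω| = d, minimum stationary probability π_min and mixing time t_mix = t_mix(1/4), whenever m ≥ c 𝓛 d t_mix² / π_min with 𝓛 = c' · ln(t_mix d/(δ π_min)) · ln ln(t_mix d/(δ π_min)), the bound (1/3) t_mix ≤ t̂_mix(X₁,…,X_m) ≤ 3 t_mix holds with probability at least 1 − δ. -/

import Mathlib

variable {Ω : Type*} [Fintype Ω] [DecidableEq Ω] [Nonempty Ω]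

/-- A probability distribution on `Ω`. -/
def IsDist (f : Ω → ℝ) : Prop := (∀ x, 0 ≤ f x) ∧ ∑ x, f x = 1

/-- A row-stochastic (Markov) matrix. -/
def IsStochastic (M : Matrix Ω Ω ℝ) : Prop :=
  (∀ i j, 0 ≤ M i j) ∧ ∀ i, ∑ j, M i j = 1

/-- Ergodicity: some power of `M` is entrywise positive. -/
def IsErgodic (M : Matrix Ω Ω ℝ) : Prop := ∃ p : ℕ, 0 < p ∧ ∀ i j, 0 < (M ^ p) i j

/-- Total variation distance between two distributions on `Ω`. -/
noncomputable def tvDist (μ ν : Ω → ℝ) : ℝ := (1 / 2) * ∑ x, |μ x - ν x|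

/-- Dobrushin contraction coefficient `κ(M) = max_{i,j} ‖M(i,·) − M(j,·)‖_TV`. -/
noncomputable def dobrushin (M : Matrix Ω Ω ℝ) : ℝ :=
  Finset.univ.sup' Finset.univ_nonempty fun p : Ω × Ω => tvDist (M p.1) (M p.2)

/-- Generalized contraction coefficient `κ̃ = 1 − sup_{s ≥ 1} (1 − κ(M^s))/s`. -/
noncomputable def genCC (M : Matrix Ω Ω ℝ) : ℝ :=
  1 - ⨆ s : {n : ℕ // 0 < n}, (1 - dobrushin (M ^ (s : ℕ))) / ((s : ℕ) : ℝ)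

/-- Distance to stationarity `h(t) = sup_{μ ∈ Δ_Ω} ‖μ M^t − π‖_TV`. -/
noncomputable def distToStat (M : Matrix Ω Ω ℝ) (π : Ω → ℝ) (t : ℕ) : ℝ :=
  ⨆ μ : {f : Ω → ℝ // IsDist f}, tvDist (Matrix.vecMul μ.1 (M ^ t)) π

/-- Mixing time `t_mix(ξ) = min{t ∈ ℕ : h(t) < ξ}` (with `ℕ = {1,2,…}`). -/
noncomputable def mixTime (M : Matrix Ω Ω ℝ) (π : Ω → ℝ) (ξ : ℝ) : ℕ :=
  sInf {t : ℕ | 0 < t ∧ distToStat M π t < ξ}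

/-- Probability of observing the trajectory `x = (X₁, …, X_m)` for the Markov chain
with initial distribution `μ` and transition matrix `M`. -/
noncomputable def pathProb (μ : Ω → ℝ) (M : Matrix Ω Ω ℝ) {m : ℕ} (x : Fin m → Ω) : ℝ :=
  if h : m = 0 then 1
  else
    μ (x ⟨0, Nat.pos_of_ne_zero h⟩) *
      ∏ t : Fin (m - 1),
        M (x ⟨t.1, by have := t.2; omega⟩) (x ⟨t.1 + 1, by have := t.2; omega⟩)

/-- Probability of an event `E` under the law of the trajectory `(X₁, …, X_m) ∼ (μ, M)`. -/
noncomputable def prTraj (μ : Ω → ℝ) (M : Matrix Ω Ω ℝ) (m : ℕ)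
    (E : Set (Fin m → Ω)) : ℝ :=
  ∑ x : Fin m → Ω, E.indicator (pathProb μ M) x

/-- `N_i^{(s)}`: number of visits to state `i` by the `s`-skipped chain, i.e. the number of
`t ∈ {1, …, ⌊(m−1)/s⌋}` such that `X_{1+s(t−1)} = i`. -/
def Nvisit (s : ℕ) {m : ℕ} (x : Fin m → Ω) (i : Ω) : ℕ :=
  ∑ t : Fin ((m - 1) / s),
    if h : s * t.1 < m then (if x ⟨s * t.1, h⟩ = i then 1 else 0) else 0

/-- `N_min^{(s)}`: the least number of visits of the `s`-skipped chain. -/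
def Nmin (s : ℕ) {m : ℕ} (x : Fin m → Ω) : ℕ :=
  Finset.univ.inf' Finset.univ_nonempty (Nvisit s x)

/-- `N_{ij}^{(s)}`: number of observed transitions `i → j` of the `s`-skipped chain. -/
def Npair (s : ℕ) {m : ℕ} (x : Fin m → Ω) (i j : Ω) : ℕ :=
  ∑ t : Fin ((m - 1) / s),
    if h : s * t.1 + s < m then
      (if x ⟨s * t.1, Nat.lt_of_le_of_lt (Nat.le_add_right _ _) h⟩ = i ∧
          x ⟨s * t.1 + s, h⟩ = j then 1 else 0)
    else 0

/-- Empirical `s`-step transition matrix `M̂^{(s)}`. -/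
noncomputable def empMat (s : ℕ) {m : ℕ} (x : Fin m → Ω) : Matrix Ω Ω ℝ :=
  Matrix.of fun i j =>
    if 0 < Nvisit s x i then (Npair s x i j : ℝ) / (Nvisit s x i : ℝ) else 0

/-- Minimum stationary probability `π_min`. -/
noncomputable def piMinOf (π : Ω → ℝ) : ℝ :=
  Finset.univ.inf' Finset.univ_nonempty π

set_option linter.unusedSectionVars false

section Stochastic

/-- Every `[0, 1]`-valued function has oscillation at most `κ` after averaging by `Q`. -/
def OscBound (Q : Matrix Ω Ω ℝ) (κ : ℝ) : Prop :=
  ∀ f : Ω → ℝ, (∀ x, 0 ≤ f x) → (∀ x, f x ≤ 1) →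
    ∀ x y, ∑ z, Q x z * f z - ∑ z, Q y z * f z ≤ κ

lemma IsStochastic.mul {P Q : Matrix Ω Ω ℝ} (hP : IsStochastic P) (hQ : IsStochastic Q) :
    IsStochastic (P * Q) := by
  refine ⟨fun i j => ?_, fun i => ?_⟩
  · rw [Matrix.mul_apply]
    exact Finset.sum_nonneg fun k _ => mul_nonneg (hP.1 _ _) (hQ.1 _ _)
  · simp only [Matrix.mul_apply]
    rw [Finset.sum_comm]
    simp [← Finset.mul_sum, hQ.2, hP.2]

lemma IsStochastic.pow {M : Matrix Ω Ω ℝ} (hM : IsStochastic M) (n : ℕ) :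
    IsStochastic (M ^ n) := by
  induction n with
  | zero =>
    refine ⟨fun i j => ?_, fun i => ?_⟩
    · rw [pow_zero, Matrix.one_apply]; split_ifs <;> norm_num
    · simp [Matrix.one_apply]
  | succ n ih => rw [pow_succ]; exact ih.mul hM

lemma IsStochastic.sum_mul_nonneg {Q : Matrix Ω Ω ℝ} (hQ : IsStochastic Q) {f : Ω → ℝ}
    (hf : ∀ x, 0 ≤ f x) (x : Ω) : 0 ≤ ∑ z, Q x z * f z :=
  Finset.sum_nonneg fun z _ => mul_nonneg (hQ.1 _ _) (hf z)

lemma IsStochastic.sum_mul_le {Q : Matrix Ω Ω ℝ} (hQ : IsStochastic Q) {f : Ω → ℝ} {c : ℝ}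
    (hf : ∀ x, f x ≤ c) (x : Ω) : ∑ z, Q x z * f z ≤ c := by
  calc ∑ z, Q x z * f z ≤ ∑ z, Q x z * c :=
        Finset.sum_le_sum fun z _ => mul_le_mul_of_nonneg_left (hf z) (hQ.1 _ _)
    _ = c := by rw [← Finset.sum_mul, hQ.2, one_mul]

lemma IsStochastic.oscBound_one {Q : Matrix Ω Ω ℝ} (hQ : IsStochastic Q) : OscBound Q 1 := by
  intro f h0 h1 x y
  linarith [hQ.sum_mul_le h1 x, hQ.sum_mul_nonneg h0 y]

lemma OscBound.mul {P Q : Matrix Ω Ω ℝ} {κ κ' : ℝ} (hP : IsStochastic P)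
    (hPκ : OscBound P κ) (hQκ : OscBound Q κ') (hκ' : 0 < κ') : OscBound (P * Q) (κ * κ') := by
  intro f h0 h1 x y
  set g : Ω → ℝ := fun z => ∑ w, Q z w * f w with hg
  have key : ∀ a, ∑ z, (P * Q) a z * f z = ∑ z, P a z * g z := by
    intro a
    simp only [Matrix.mul_apply, Finset.sum_mul, hg, Finset.mul_sum]
    rw [Finset.sum_comm]
    simp [mul_assoc]
  obtain ⟨b, hb⟩ := Finite.exists_min g
  have hosc := hPκ (fun z => (g z - g b) / κ') (fun z => div_nonneg (by linarith [hb z]) hκ'.le)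
    (fun z => by rw [div_le_one hκ']; exact hQκ f h0 h1 z b) x y
  have e : ∀ a, ∑ z, P a z * ((g z - g b) / κ') = (∑ z, P a z * g z - g b) / κ' := by
    intro a
    have : ∀ z, P a z * ((g z - g b) / κ') = (P a z * g z - P a z * g b) / κ' := by
      intro z; ring
    simp only [this, ← Finset.sum_div, Finset.sum_sub_distrib, ← Finset.sum_mul, hP.2, one_mul]
  rw [e, e, ← sub_div, div_le_iff₀ hκ'] at hosc
  rw [key, key]
  linarith

lemma OscBound.pow_mul_add {M : Matrix Ω Ω ℝ} {κ : ℝ} {t : ℕ} (hM : IsStochastic M) (hκ : 0 < κ)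
    (h : OscBound (M ^ t) κ) (n r : ℕ) : OscBound (M ^ (t * n + r)) (κ ^ n) := by
  induction n with
  | zero => simpa using (hM.pow r).oscBound_one
  | succ n ih =>
    have := OscBound.mul (hM.pow t) h ih (pow_pos hκ n)
    rwa [← pow_add, ← pow_succ', ← add_assoc, add_comm t, ← Nat.mul_succ] at this

lemma vecMul_pow_eq {M : Matrix Ω Ω ℝ} {π : Ω → ℝ} (h : Matrix.vecMul π M = π) (n : ℕ) :
    Matrix.vecMul π (M ^ n) = π := by
  induction n with
  | zero => simp
  | succ n ih => rw [pow_succ, ← Matrix.vecMul_vecMul, ih, h]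

lemma OscBound.abs_sub_le {Q : Matrix Ω Ω ℝ} {π : Ω → ℝ} {κ : ℝ} (h : OscBound Q κ)
    (hπ : IsDist π) (hst : Matrix.vecMul π Q = π) (x i : Ω) : |Q x i - π i| ≤ κ := by
  have hd : ∀ x y, Q x i - Q y i ≤ κ := by
    intro x y
    have := h (fun z => if z = i then 1 else 0) (fun z => by split_ifs <;> norm_num)
      (fun z => by split_ifs <;> norm_num) x y
    simpa using this
  have hi : ∑ y, π y * Q y i = π i := congrFun hst i
  have h1 : Q x i = ∑ y, π y * Q x i := by rw [← Finset.sum_mul, hπ.2, one_mul]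
  have hk : κ = ∑ y, π y * κ := by rw [← Finset.sum_mul, hπ.2, one_mul]
  rw [abs_le, ← hi]
  constructor
  · rw [h1, hk, neg_le_sub_iff_le_add, ← Finset.sum_add_distrib]
    refine Finset.sum_le_sum fun y _ => ?_
    rw [← mul_add]
    exact mul_le_mul_of_nonneg_left (by linarith [hd y x]) (hπ.1 y)
  · rw [h1, hk, ← Finset.sum_sub_distrib]
    refine Finset.sum_le_sum fun y _ => ?_
    rw [← mul_sub]
    exact mul_le_mul_of_nonneg_left (hd x y) (hπ.1 y)

end Stochastic

section MixingTime

lemma sum_mul_sub_le_tvDist {μ ν f : Ω → ℝ} (hμ : IsDist μ) (hν : IsDist ν)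
    (h0 : ∀ x, 0 ≤ f x) (h1 : ∀ x, f x ≤ 1) :
    ∑ x, μ x * f x - ∑ x, ν x * f x ≤ tvDist μ ν := by
  have e : ∑ x, μ x * f x - ∑ x, ν x * f x = ∑ x, (μ x - ν x) * (f x - 1 / 2) := by
    have : ∀ x, (μ x - ν x) * (f x - 1 / 2) = μ x * f x - ν x * f x - (μ x - ν x) / 2 :=
      fun x => by ring
    simp only [this, Finset.sum_sub_distrib, ← Finset.sum_div, hμ.2, hν.2]
    ring
  rw [e, tvDist, Finset.mul_sum]
  refine Finset.sum_le_sum fun x _ => (le_abs_self _).trans ?_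
  rw [abs_mul, mul_comm]
  exact mul_le_mul_of_nonneg_right (abs_le.2 ⟨by linarith [h0 x], by linarith [h1 x]⟩)
    (abs_nonneg _)

lemma tvDist_comm (μ ν : Ω → ℝ) : tvDist μ ν = tvDist ν μ := by
  simp only [tvDist, abs_sub_comm]

lemma tvDist_le_one {μ ν : Ω → ℝ} (hμ : IsDist μ) (hν : IsDist ν) : tvDist μ ν ≤ 1 := by
  have : ∑ x, |μ x - ν x| ≤ ∑ x, (μ x + ν x) := by
    refine Finset.sum_le_sum fun x _ => ?_
    rw [abs_le]
    constructor <;> linarith [hμ.1 x, hν.1 x]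
  rw [Finset.sum_add_distrib, hμ.2, hν.2] at this
  rw [tvDist]; linarith

lemma tvDist_eq_sum_filter {μ ν : Ω → ℝ} (hμ : IsDist μ) (hν : IsDist ν) :
    tvDist μ ν = ∑ x with ν x ≤ μ x, (μ x - ν x) := by
  have h : ∀ x, |μ x - ν x| = 2 * (if ν x ≤ μ x then μ x - ν x else 0) - (μ x - ν x) := by
    intro x
    split_ifs with hx
    · rw [abs_of_nonneg (by linarith)]; ring
    · rw [abs_of_neg (by linarith)]; ring
  rw [tvDist, Finset.sum_congr rfl fun x _ => h x, Finset.sum_sub_distrib, ← Finset.mul_sum,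
    Finset.sum_sub_distrib, hμ.2, hν.2, Finset.sum_filter]
  ring

lemma IsDist.vecMul {μ : Ω → ℝ} {Q : Matrix Ω Ω ℝ} (hμ : IsDist μ) (hQ : IsStochastic Q) :
    IsDist (Matrix.vecMul μ Q) := by
  refine ⟨fun x => Finset.sum_nonneg fun y _ => mul_nonneg (hμ.1 y) (hQ.1 _ _), ?_⟩
  simp only [Matrix.vecMul, dotProduct]
  rw [Finset.sum_comm]
  simp [← Finset.mul_sum, hQ.2, hμ.2]

lemma distToStat_le {M : Matrix Ω Ω ℝ} {π : Ω → ℝ} {t : ℕ} {κ : ℝ} (hM : IsStochastic M)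
    (hπ : IsDist π) (hst : Matrix.vecMul π M = π)
    (h : ∀ (A : Finset Ω) i j, ∑ y ∈ A, (M ^ t) i y - ∑ y ∈ A, (M ^ t) j y ≤ κ) :
    distToStat M π t ≤ κ := by
  have : Nonempty {f : Ω → ℝ // IsDist f} := ⟨⟨π, hπ⟩⟩
  refine ciSup_le fun μ => ?_
  have hμ := μ.2
  rw [tvDist_eq_sum_filter (hμ.vecMul (hM.pow t)) hπ]
  set A := Finset.univ.filter fun x => π x ≤ Matrix.vecMul μ.1 (M ^ t) x
  have e : ∀ ν : Ω → ℝ, ∑ x ∈ A, Matrix.vecMul ν (M ^ t) x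
      = ∑ i, ν i * ∑ x ∈ A, (M ^ t) i x := by
    intro ν
    simp only [Matrix.vecMul, dotProduct, Finset.mul_sum]
    rw [Finset.sum_comm]
  have e2 := e π
  rw [vecMul_pow_eq hst] at e2
  rw [Finset.sum_sub_distrib, e, e2]
  have h3 : ∀ j, ∑ i, μ.1 i * ∑ x ∈ A, (M ^ t) i x ≤ κ + ∑ x ∈ A, (M ^ t) j x := by
    intro j
    calc _ ≤ ∑ i, μ.1 i * (κ + ∑ x ∈ A, (M ^ t) j x) :=
          Finset.sum_le_sum fun i _ => mul_le_mul_of_nonneg_left (by linarith [h A i j]) (hμ.1 i)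
      _ = _ := by rw [← Finset.sum_mul, hμ.2, one_mul]
  have h4 : ∑ j, π j * (∑ i, μ.1 i * ∑ x ∈ A, (M ^ t) i x - κ)
      ≤ ∑ j, π j * ∑ x ∈ A, (M ^ t) j x :=
    Finset.sum_le_sum fun j _ => mul_le_mul_of_nonneg_left (by linarith [h3 j]) (hπ.1 j)
  rw [← Finset.sum_mul, hπ.2, one_mul] at h4
  linarith

lemma OscBound.sum_sub_sum_le {Q : Matrix Ω Ω ℝ} {κ : ℝ} (h : OscBound Q κ) (A : Finset Ω)
    (i j : Ω) : ∑ y ∈ A, Q i y - ∑ y ∈ A, Q j y ≤ κ := by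
  have := h (fun z => if z ∈ A then 1 else 0) (fun z => by split_ifs <;> norm_num)
      (fun z => by split_ifs <;> norm_num) i j
  simpa using this

lemma oscBound_of_distToStat {M : Matrix Ω Ω ℝ} {π : Ω → ℝ} {t : ℕ} (hM : IsStochastic M)
    (hπ : IsDist π) : OscBound (M ^ t) (2 * distToStat M π t) := by
  intro f h0 h1 x y
  have hrow : ∀ x, IsDist ((M ^ t) x) := fun x => ⟨(hM.pow t).1 x, (hM.pow t).2 x⟩
  have hbdd : BddAbove (Set.range fun μ : {f : Ω → ℝ // IsDist f} =>
      tvDist (Matrix.vecMul μ.1 (M ^ t)) π) := by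
    refine ⟨1, ?_⟩
    rintro _ ⟨μ, rfl⟩
    exact tvDist_le_one (μ.2.vecMul (hM.pow t)) hπ
  have hle : ∀ x, tvDist ((M ^ t) x) π ≤ distToStat M π t := by
    intro x
    have hd : IsDist (Pi.single x 1 : Ω → ℝ) := by
      refine ⟨fun z => ?_, by simp⟩
      rw [Pi.single_apply]; split_ifs <;> norm_num
    have := le_ciSup hbdd ⟨_, hd⟩
    simp only [Matrix.single_one_vecMul] at this
    exact this
  have a1 := sum_mul_sub_le_tvDist (hrow x) hπ h0 h1
  have a2 := sum_mul_sub_le_tvDist hπ (hrow y) h0 h1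
  rw [tvDist_comm] at a2
  linarith [hle x, hle y]

lemma IsErgodic.exists_oscBound {M : Matrix Ω Ω ℝ} (hM : IsStochastic M) (hE : IsErgodic M) :
    ∃ p, 0 < p ∧ ∃ κ : ℝ, 0 < κ ∧ κ < 1 ∧ OscBound (M ^ p) κ := by
  obtain ⟨p, hp, hpos⟩ := hE
  obtain ⟨q, hq⟩ := Finite.exists_min fun q : Ω × Ω => (M ^ p) q.1 q.2
  set α := (M ^ p) q.1 q.2 with hα
  have hα0 : 0 < α := hpos _ _
  have hα1 : ∀ x z, α ≤ (M ^ p) x z := fun x z => hq (x, z)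
  refine ⟨p, hp, max (1 - α) (1 / 2), by positivity, max_lt (by linarith) (by norm_num), ?_⟩
  intro f h0 h1 x y
  refine le_trans ?_ (le_max_left _ _)
  have u1 : ∑ z, α * (1 - f z) ≤ ∑ z, (M ^ p) x z * (1 - f z) :=
    Finset.sum_le_sum fun z _ => mul_le_mul_of_nonneg_right (hα1 x z) (by linarith [h1 z])
  have u2 : ∑ z, α * f z ≤ ∑ z, (M ^ p) y z * f z :=
    Finset.sum_le_sum fun z _ => mul_le_mul_of_nonneg_right (hα1 y z) (h0 z)
  have u3 : ∑ z, (M ^ p) x z * (1 - f z) = 1 - ∑ z, (M ^ p) x z * f z := by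
    simp [mul_sub, Finset.sum_sub_distrib, (hM.pow p).2]
  have u4 : ∑ z, α * (1 - f z) + ∑ z, α * f z = ∑ _z : Ω, α := by
    rw [← Finset.sum_add_distrib]
    exact Finset.sum_congr rfl fun z _ => by ring
  have u5 : α ≤ ∑ _z : Ω, α :=
    Finset.single_le_sum (f := fun _ => α) (fun _ _ => hα0.le) (Finset.mem_univ q.1)
  linarith

lemma mixTime_spec {M : Matrix Ω Ω ℝ} {π : Ω → ℝ} (hM : IsStochastic M) (hE : IsErgodic M)
    (hπ : IsDist π) (hst : Matrix.vecMul π M = π) {ξ : ℝ} (hξ : 0 < ξ) :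
    0 < mixTime M π ξ ∧ distToStat M π (mixTime M π ξ) < ξ := by
  refine Nat.sInf_mem (s := {t : ℕ | 0 < t ∧ distToStat M π t < ξ}) ?_
  obtain ⟨p, hp, κ, h0, h1, h⟩ := hE.exists_oscBound hM
  obtain ⟨n, hn⟩ := exists_pow_lt_of_lt_one hξ h1
  refine ⟨p * n + p, by positivity, lt_of_le_of_lt (distToStat_le hM hπ hst ?_) hn⟩
  exact (h.pow_mul_add hM h0 n p).sum_sub_sum_le

lemma mixTime_le {M : Matrix Ω Ω ℝ} {π : Ω → ℝ} {ξ : ℝ} {t : ℕ} (ht : 0 < t)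
    (h : distToStat M π t < ξ) : mixTime M π ξ ≤ t := Nat.sInf_le ⟨ht, h⟩

lemma IsErgodic.pos {M : Matrix Ω Ω ℝ} {π : Ω → ℝ} (hE : IsErgodic M)
    (hπ : IsDist π) (hst : Matrix.vecMul π M = π) (i : Ω) : 0 < π i := by
  obtain ⟨p, -, hpos⟩ := hE
  have hi : ∑ y, π y * (M ^ p) y i = π i := congrFun (vecMul_pow_eq hst p) i
  rw [← hi]
  obtain ⟨j, -, hj⟩ : ∃ j ∈ Finset.univ, 0 < π j := by
    by_contra! hcon
    have := Finset.sum_nonpos hcon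
    rw [hπ.2] at this
    norm_num at this
  exact Finset.sum_pos' (fun y _ => mul_nonneg (hπ.1 y) (hpos _ _).le)
    ⟨j, Finset.mem_univ _, mul_pos hj (hpos _ _)⟩

end MixingTime

section Poisson

lemma sum_half_pow_div_le (t n : ℕ) (ht : 0 < t) :
    ∑ k ∈ Finset.range (t * n), ((1 / 2 : ℝ)) ^ (k / t) ≤ 2 * t := by
  have h : ∀ n, ∑ k ∈ Finset.range (t * n), ((1 / 2 : ℝ)) ^ (k / t)
      = 2 * t * (1 - (1 / 2) ^ n) := by
    intro n
    induction n with
    | zero => simp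
    | succ n ih =>
      rw [Nat.mul_succ, Finset.sum_range_add, ih]
      have : ∀ x ∈ Finset.range t, (1 / 2 : ℝ) ^ ((t * n + x) / t) = (1 / 2) ^ n := by
        intro x hx
        rw [Nat.mul_add_div ht, Nat.div_eq_of_lt (Finset.mem_range.1 hx), add_zero]
      rw [Finset.sum_congr rfl this, Finset.sum_const, Finset.card_range, nsmul_eq_mul, pow_succ]
      ring
  rw [h]
  have : (0 : ℝ) ≤ (1 / 2) ^ n := by positivity
  nlinarith [(Nat.cast_nonneg t : (0 : ℝ) ≤ t)]

/-- An approximate solution of the Poisson equation for visits of `M ^ s` to the state `i`,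
bounded in terms of the mixing time only. -/
lemma exists_approx_poisson {M : Matrix Ω Ω ℝ} {π : Ω → ℝ} {t s : ℕ} (hM : IsStochastic M)
    (hπ : IsDist π) (hst : Matrix.vecMul π M = π) (ht : 0 < t) (hs : 0 < s)
    (hosc : OscBound (M ^ t) (1 / 2)) {i : Ω} (hi : 0 < π i) :
    ∃ g : Ω → ℝ, (∀ x, |g x| ≤ 2 * t) ∧
      ∀ x, g x - (if x = i then 1 else 0) + π i / 2 ≤ ∑ z, (M ^ s) x z * g z := by
  have hdec : ∀ k x, |(M ^ (s * k)) x i - π i| ≤ (1 / 2 : ℝ) ^ (k / t) := by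
    intro k x
    have h1 : s * k = t * (k / t) + (s * k - t * (k / t)) := by
      have : t * (k / t) ≤ k := Nat.mul_div_le k t
      have : k ≤ s * k := Nat.le_mul_of_pos_left k hs
      omega
    have h2 := hosc.pow_mul_add hM (by norm_num) (k / t) (s * k - t * (k / t))
    rw [← h1] at h2
    exact h2.abs_sub_le hπ (vecMul_pow_eq hst _) x i
  obtain ⟨n, hn⟩ := exists_pow_lt_of_lt_one (half_pos hi) (by norm_num : (1 / 2 : ℝ) < 1)
  refine ⟨fun x => ∑ k ∈ Finset.range (t * n), ((M ^ (s * k)) x i - π i), fun x => ?_,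
    fun x => ?_⟩
  · exact (Finset.abs_sum_le_sum_abs _ _).trans
      ((Finset.sum_le_sum fun k _ => hdec k x).trans (sum_half_pow_div_le t n ht))
  · have e : ∑ z, (M ^ s) x z * ∑ k ∈ Finset.range (t * n), ((M ^ (s * k)) z i - π i)
        = ∑ k ∈ Finset.range (t * n), ((M ^ (s * (k + 1))) x i - π i) := by
      simp only [Finset.mul_sum]
      rw [Finset.sum_comm]
      refine Finset.sum_congr rfl fun k _ => ?_
      simp only [mul_sub, Finset.sum_sub_distrib, ← Finset.sum_mul, (hM.pow s).2, one_mul]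
      rw [mul_add, mul_one, add_comm, pow_add, Matrix.mul_apply]
    have h1 := Finset.sum_range_succ (fun k => (M ^ (s * k)) x i - π i) (t * n)
    have h2 := Finset.sum_range_succ' (fun k => (M ^ (s * k)) x i - π i) (t * n)
    have h3 := abs_le.1 (hdec (t * n) x)
    rw [Nat.mul_div_cancel_left n ht] at h3
    have h4 : (M ^ (s * 0)) x i = if x = i then 1 else 0 := by
      rw [mul_zero, pow_zero, Matrix.one_apply]
    rw [e]
    rw [h4] at h2
    linarith [h3.1]

end Poisson

section Lyapunov

/-- The centred reward collected on a transition `x → z` when estimating the probability of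
jumping from `i` into `A`; its sum is nonnegative when the empirical frequency is too large. -/
noncomputable def excess (i : Ω) (A : Finset Ω) (q : ℝ) (x z : Ω) : ℝ :=
  if x = i then (if z ∈ A then 1 else 0) - q else 0

lemma sum_exp_excess_le {Q : Matrix Ω Ω ℝ} (hQ : IsStochastic Q) (i : Ω) (A : Finset Ω) :
    ∑ z, Q i z * Real.exp (1 / 512 * excess i A (∑ y ∈ A, Q i y + 1 / 64) i z)
      ≤ 1 - 1 / 65536 := by
  set p := ∑ y ∈ A, Q i y with hp
  have hp0 : 0 ≤ p := Finset.sum_nonneg fun y _ => hQ.1 _ _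
  have hp1 : p ≤ 1 := by
    rw [← hQ.2 i]
    exact Finset.sum_le_sum_of_subset_of_nonneg (Finset.subset_univ A) fun y _ _ => hQ.1 _ _
  have hz : ∀ z, Real.exp (1 / 512 * excess i A (p + 1 / 64) i z)
      ≤ 1 + 1 / 512 * ((if z ∈ A then 1 else 0) - (p + 1 / 64)) + 1 / 65536 := by
    intro z
    simp only [excess, if_true]
    set w : ℝ := (if z ∈ A then 1 else 0) - (p + 1 / 64) with hw
    have hw1 : |w| ≤ 2 := by
      rw [hw, abs_le]; split_ifs <;> constructor <;> linarith
    have hx : |1 / 512 * w| ≤ 1 := by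
      rw [abs_mul, abs_of_pos (by norm_num : (0 : ℝ) < 1 / 512)]; linarith
    have h1 := (abs_le.1 (Real.abs_exp_sub_one_sub_id_le hx)).2
    have h2 : w ^ 2 ≤ 4 := by nlinarith [abs_le.1 hw1]
    nlinarith
  calc _ ≤ ∑ z, Q i z * (1 + 1 / 512 * ((if z ∈ A then 1 else 0) - (p + 1 / 64)) + 1 / 65536) :=
        Finset.sum_le_sum fun z _ => mul_le_mul_of_nonneg_left (hz z) (hQ.1 _ _)
    _ = ∑ z, (Q i z * (1 + 1 / 65536 - 1 / 512 * (p + 1 / 64))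
          + 1 / 512 * (Q i z * (if z ∈ A then 1 else 0))) :=
        Finset.sum_congr rfl fun z _ => by ring
    _ = (1 + 1 / 65536 - 1 / 512 * (p + 1 / 64)) + 1 / 512 * p := by
        rw [Finset.sum_add_distrib, ← Finset.sum_mul, hQ.2, ← Finset.mul_sum]
        simp [hp]
    _ ≤ 1 - 1 / 65536 := by linarith

/-- A Lyapunov function for the exponentially tilted `s`-step kernel. -/
lemma exists_lyapunov {M : Matrix Ω Ω ℝ} {π : Ω → ℝ} {t s : ℕ} (hM : IsStochastic M)
    (hπ : IsDist π) (hst : Matrix.vecMul π M = π) (ht : 0 < t) (hs : 0 < s)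
    (hosc : OscBound (M ^ t) (1 / 2)) {i : Ω} (hi : 0 < π i) (A : Finset Ω) :
    ∃ v : Ω → ℝ, (∀ x, 1 ≤ v x) ∧ (∀ x, v x ≤ 2) ∧
      ∀ x, ∑ z, (M ^ s) x z * (Real.exp (1 / 512 *
          excess i A (∑ y ∈ A, (M ^ s) i y + 1 / 64) x z) * v z)
        ≤ (1 - π i / (2 ^ 22 * t)) * v x := by
  obtain ⟨g, hg, hPg⟩ := exists_approx_poisson hM hπ hst ht hs hosc hi
  have ht1 : (1 : ℝ) ≤ t := by exact_mod_cast ht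
  have hπ1 : π i ≤ 1 := by
    rw [← hπ.2]; exact Finset.single_le_sum (fun y _ => hπ.1 y) (Finset.mem_univ i)
  obtain ⟨ρ, hρ⟩ : ∃ ρ : ℝ, ρ = 1 / 262144 := ⟨_, rfl⟩
  obtain ⟨b, hb⟩ : ∃ b : ℝ, b = ρ / (2 * t) := ⟨_, rfl⟩
  have hρ0 : 0 < ρ := by rw [hρ]; norm_num
  have hb0 : 0 < b := by rw [hb]; positivity
  have hbg : ∀ x, |b * g x| ≤ ρ := by
    intro x
    rw [abs_mul, abs_of_pos hb0]
    calc b * |g x| ≤ b * (2 * t) := mul_le_mul_of_nonneg_left (hg x) hb0.le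
      _ = ρ := by rw [hb]; field_simp
  have hη : π i / (2 ^ 22 * t) = b * π i / 8 := by
    rw [hb, hρ]; field_simp; norm_num
  have hbρ : b ≤ ρ := by
    rw [hb]; exact div_le_self (by positivity) (by linarith)
  have hη1 : b * π i ≤ ρ := by nlinarith
  have hη0 : 0 < b * π i := mul_pos hb0 hi
  -- The unnormalised Lyapunov function takes values in `[1 - ρ, 1 + ρ]`.
  set u : Ω → ℝ := fun x => 1 - b * g x with hu
  have hu0 : ∀ x, 1 - ρ ≤ u x := fun x => by
    simp only [hu]; linarith [(abs_le.1 (hbg x)).2]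
  have hu1 : ∀ x, u x ≤ 1 + ρ := fun x => by
    simp only [hu]; linarith [(abs_le.1 (hbg x)).1]
  have main : ∀ x, ∑ z, (M ^ s) x z * (Real.exp (1 / 512 *
          excess i A (∑ y ∈ A, (M ^ s) i y + 1 / 64) x z) * u z)
        ≤ (1 - b * π i / 8) * u x := by
    intro x
    by_cases hx : x = i
    · subst hx
      calc _ ≤ ∑ z, (M ^ s) x z * (Real.exp (1 / 512 *
              excess x A (∑ y ∈ A, (M ^ s) x y + 1 / 64) x z) * (1 + ρ)) := by
            refine Finset.sum_le_sum fun z _ => mul_le_mul_of_nonneg_left ?_ ((hM.pow s).1 _ _)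
            exact mul_le_mul_of_nonneg_left (hu1 z) (Real.exp_nonneg _)
        _ ≤ (1 - 1 / 65536) * (1 + ρ) := by
            simp only [← mul_assoc]
            rw [← Finset.sum_mul]
            exact mul_le_mul_of_nonneg_right (sum_exp_excess_le (hM.pow s) x A) (by positivity)
        _ ≤ (1 - ρ) * (1 - ρ) := by rw [hρ]; norm_num
        _ ≤ _ := mul_le_mul (by linarith) (hu0 x) (by linarith) (by linarith)
    · have h1 := hPg x
      simp only [hx, if_false] at h1
      have h2 : ∑ z, (M ^ s) x z * u z = 1 - b * ∑ z, (M ^ s) x z * g z := by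
        simp only [hu, mul_sub, Finset.sum_sub_distrib, mul_one, (hM.pow s).2, Finset.mul_sum]
        congr 1
        exact Finset.sum_congr rfl fun z _ => by ring
      simp only [excess, hx, if_false, mul_zero, Real.exp_zero, one_mul]
      rw [h2]
      have h3 : b * (g x + π i / 2) ≤ b * ∑ z, (M ^ s) x z * g z :=
        mul_le_mul_of_nonneg_left (by linarith) hb0.le
      have h4 : u x = 1 - b * g x := rfl
      have h5 : b * π i / 8 * u x ≤ b * π i / 8 * 2 :=
        mul_le_mul_of_nonneg_left (by linarith [hu1 x]) (by positivity)
      linarith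
  have hρ1 : 0 < 1 - ρ := by linarith
  refine ⟨fun x => u x / (1 - ρ), fun x => ?_, fun x => ?_, fun x => ?_⟩
  · rw [le_div_iff₀ hρ1]; linarith [hu0 x]
  · rw [div_le_iff₀ hρ1]; linarith [hu1 x]
  · simp only [← mul_div_assoc, ← Finset.sum_div]
    rw [hη]
    exact div_le_div_of_nonneg_right (main x) hρ1.le

end Lyapunov

section Trajectory

/-- Prepend a state to an infinite trajectory. -/
def consTraj (a : Ω) (y : ℕ → Ω) : ℕ → Ω
  | 0 => a
  | k + 1 => y k

/-- Expectation of `F` under `n` steps of the chain `M` started at `a` and then frozen. -/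
noncomputable def trajExp (M : Matrix Ω Ω ℝ) : ℕ → Ω → ((ℕ → Ω) → ℝ) → ℝ
  | 0, a, F => F fun _ => a
  | n + 1, a, F => ∑ b, M a b * trajExp M n b fun y => F (consTraj a y)

lemma trajExp_mono {M : Matrix Ω Ω ℝ} (hM : IsStochastic M) (n : ℕ) (a : Ω)
    {F G : (ℕ → Ω) → ℝ} (h : ∀ y, y 0 = a → F y ≤ G y) : trajExp M n a F ≤ trajExp M n a G := by
  induction n generalizing a F G with
  | zero => exact h _ rfl
  | succ n ih =>
    exact Finset.sum_le_sum fun b _ =>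
      mul_le_mul_of_nonneg_left (ih b fun y _ => h _ rfl) (hM.1 _ _)

lemma trajExp_const {M : Matrix Ω Ω ℝ} (hM : IsStochastic M) (n : ℕ) (a : Ω) (c : ℝ) :
    trajExp M n a (fun _ => c) = c := by
  induction n generalizing a with
  | zero => rfl
  | succ n ih => simp [trajExp, ih, ← Finset.sum_mul, hM.2]

lemma trajExp_const_mul (M : Matrix Ω Ω ℝ) (n : ℕ) (a : Ω) (c : ℝ) (F : (ℕ → Ω) → ℝ) :
    trajExp M n a (fun y => c * F y) = c * trajExp M n a F := by
  induction n generalizing a F with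
  | zero => rfl
  | succ n ih =>
    simp only [trajExp, ih, Finset.mul_sum]
    exact Finset.sum_congr rfl fun b _ => by ring

/-- The Markov property at time `s`. -/
lemma trajExp_shift (M : Matrix Ω Ω ℝ) (n s : ℕ) (a : Ω) (G : (ℕ → Ω) → ℝ) :
    trajExp M (n + s) a (fun y => G fun k => y (k + s)) =
      ∑ b, (M ^ s) a b * trajExp M n b G := by
  induction s generalizing a with
  | zero => simp [Matrix.one_apply]
  | succ s ih =>
    have h : ∀ c, trajExp M (n + s) c (fun y => G fun k => consTraj a y (k + (s + 1))) =
        ∑ b, (M ^ s) c b * trajExp M n b G := fun c => ih c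
    rw [← add_assoc, trajExp]
    simp only [h, pow_succ', Matrix.mul_apply, Finset.sum_mul, Finset.mul_sum]
    rw [Finset.sum_comm]
    simp only [mul_assoc]

lemma trajExp_congr {M : Matrix Ω Ω ℝ} (hM : IsStochastic M) (n : ℕ) (a : Ω)
    {F G : (ℕ → Ω) → ℝ} (h : ∀ y, y 0 = a → F y = G y) : trajExp M n a F = trajExp M n a G :=
  le_antisymm (trajExp_mono hM n a fun y hy => (h y hy).le)
    (trajExp_mono hM n a fun y hy => (h y hy).ge)

/-- Sum of `φ` over the first `K` transitions of the `s`-skipped trajectory. -/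
noncomputable def skipSum (s K : ℕ) (φ : Ω → Ω → ℝ) (y : ℕ → Ω) : ℝ :=
  ∑ k ∈ Finset.range K, φ (y (s * k)) (y (s * k + s))

lemma skipSum_succ (s K : ℕ) (φ : Ω → Ω → ℝ) (y : ℕ → Ω) :
    skipSum s (K + 1) φ y = skipSum s K φ (fun k => y (k + s)) + φ (y 0) (y (0 + s)) := by
  simp only [skipSum, Finset.sum_range_succ' _ K, Nat.mul_add, mul_one, mul_zero]

lemma trajExp_exp_skipSum_le {M : Matrix Ω Ω ℝ} (hM : IsStochastic M) {s : ℕ}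
    {φ : Ω → Ω → ℝ} {v : Ω → ℝ} {c : ℝ} (hc : 0 ≤ c) (hv : ∀ x, 1 ≤ v x)
    (h : ∀ x, ∑ z, (M ^ s) x z * (Real.exp (φ x z) * v z) ≤ c * v x) (K r : ℕ) (a : Ω) :
    trajExp M (s * K + r) a (fun y => Real.exp (skipSum s K φ y)) ≤ c ^ K * v a := by
  induction K generalizing a with
  | zero => simpa [skipSum, trajExp_const hM] using hv a
  | succ K ih =>
    have e1 : s * (K + 1) + r = (s * K + r) + s := by ring
    have e2 := trajExp_shift M (s * K + r) s a
      fun y => Real.exp (φ a (y 0)) * Real.exp (skipSum s K φ y)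
    rw [e1, trajExp_congr hM _ a (G := fun y => Real.exp (φ a (y (0 + s))) *
      Real.exp (skipSum s K φ fun k => y (k + s)))
      (fun y hy => by rw [skipSum_succ, Real.exp_add, hy, mul_comm]), e2]
    calc _ ≤ ∑ b, (M ^ s) a b * (Real.exp (φ a b) * (c ^ K * v b)) := by
          refine Finset.sum_le_sum fun b _ => mul_le_mul_of_nonneg_left ?_ ((hM.pow s).1 _ _)
          rw [trajExp_congr hM _ b (G := fun y => Real.exp (φ a b) * Real.exp (skipSum s K φ y))
            (fun y hy => by rw [hy]), trajExp_const_mul]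
          exact mul_le_mul_of_nonneg_left (ih b) (Real.exp_nonneg _)
      _ = c ^ K * ∑ b, (M ^ s) a b * (Real.exp (φ a b) * v b) := by
          rw [Finset.mul_sum]
          exact Finset.sum_congr rfl fun b _ => by ring
      _ ≤ c ^ K * (c * v a) := mul_le_mul_of_nonneg_left (h a) (pow_nonneg hc K)
      _ = c ^ (K + 1) * v a := by ring

end Trajectory

section PathLaw

lemma pathProb_succ (μ : Ω → ℝ) (M : Matrix Ω Ω ℝ) {n : ℕ} (x : Fin (n + 1) → Ω) :
    pathProb μ M x = μ (x 0) * ∏ k : Fin n, M (x k.castSucc) (x k.succ) := rfl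

lemma sum_pathProb_mul (μ : Ω → ℝ) (M : Matrix Ω Ω ℝ) (n : ℕ) (F : (Fin (n + 1) → Ω) → ℝ) :
    ∑ x, pathProb μ M x * F x =
      ∑ a, μ a * trajExp M n a fun y => F fun k => y k := by
  induction n generalizing μ with
  | zero =>
    rw [← (Equiv.funUnique (Fin 1) Ω).symm.sum_comp]
    simp [pathProb_succ, trajExp]
    rfl
  | succ n ih =>
    rw [← (Fin.consEquiv fun _ : Fin (n + 2) => Ω).sum_comp, Fintype.sum_prod_type]
    refine Finset.sum_congr rfl fun a _ => ?_
    have h : ∀ x : Fin (n + 1) → Ω,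
        pathProb μ M ((Fin.consEquiv fun _ : Fin (n + 2) => Ω) (a, x)) *
            F ((Fin.consEquiv fun _ : Fin (n + 2) => Ω) (a, x)) =
          μ a * (pathProb (M a) M x * F (Fin.cons a x)) := by
      intro x
      change pathProb μ M (Fin.cons a x : Fin (n + 2) → Ω) * F (Fin.cons a x) = _
      simp only [pathProb_succ, Fin.prod_univ_succ, Fin.cons_zero,
        Fin.castSucc_zero, Fin.cons_succ, ← Fin.succ_castSucc]
      ring
    rw [Finset.sum_congr rfl fun x _ => h x, ← Finset.mul_sum, ih, trajExp]
    congr 1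
    refine Finset.sum_congr rfl fun b _ => ?_
    congr 2
    funext y
    congr 1
    funext k
    refine Fin.cases ?_ (fun k => ?_) k
    · rfl
    · rfl

lemma pathProb_nonneg {μ : Ω → ℝ} {M : Matrix Ω Ω ℝ} (hμ : IsDist μ)
    (hM : IsStochastic M) {m : ℕ} (x : Fin m → Ω) : 0 ≤ pathProb μ M x := by
  unfold pathProb
  split_ifs
  · exact zero_le_one
  · exact mul_nonneg (hμ.1 _) (Finset.prod_nonneg fun _ _ => hM.1 _ _)

lemma sum_pathProb {μ : Ω → ℝ} {M : Matrix Ω Ω ℝ} (hμ : IsDist μ) (hM : IsStochastic M) (m : ℕ) :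
    ∑ x : Fin m → Ω, pathProb μ M x = 1 := by
  cases m with
  | zero => simp [pathProb]
  | succ n =>
    have := sum_pathProb_mul μ M n fun _ => 1
    simpa [trajExp_const hM, hμ.2] using this

/-- Extend a finite trajectory to an infinite one. -/
def extTraj {n : ℕ} (x : Fin (n + 1) → Ω) (k : ℕ) : Ω :=
  if h : k < n + 1 then x ⟨k, h⟩ else x 0

lemma skipSum_extTraj {n s K : ℕ} (h : s * K ≤ n) (φ : Ω → Ω → ℝ) (y : ℕ → Ω) :
    skipSum s K φ (extTraj fun k : Fin (n + 1) => y k) = skipSum s K φ y := by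
  have hy : ∀ k ≤ n, extTraj (fun k : Fin (n + 1) => y k) k = y k := by
    intro k hk
    rw [extTraj, dif_pos (Nat.lt_succ_of_le hk)]
  refine Finset.sum_congr rfl fun k hk => ?_
  have : s * (k + 1) ≤ s * K := Nat.mul_le_mul_left s (Finset.mem_range.1 hk)
  rw [mul_add, mul_one] at this
  rw [hy _ (by omega), hy _ (by omega)]

lemma prTraj_excess_le {M : Matrix Ω Ω ℝ} {μ π : Ω → ℝ} {t s : ℕ} (hM : IsStochastic M)
    (hμ : IsDist μ) (hπ : IsDist π) (hst : Matrix.vecMul π M = π) (ht : 0 < t) (hs : 0 < s)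
    (hosc : OscBound (M ^ t) (1 / 2)) {i : Ω} (hi : 0 < π i) (A : Finset Ω) (n : ℕ) :
    prTraj μ M (n + 1) {x | 0 ≤ skipSum s (n / s)
        (excess i A (∑ y ∈ A, (M ^ s) i y + 1 / 64)) (extTraj x)}
      ≤ 2 * (1 - π i / (2 ^ 22 * t)) ^ (n / s) := by
  obtain ⟨v, hv1, hv2, hv⟩ := exists_lyapunov hM hπ hst ht hs hosc hi A
  set φ := excess i A (∑ y ∈ A, (M ^ s) i y + 1 / 64)
  set c := 1 - π i / (2 ^ 22 * t) with hc
  have hπ1 : π i ≤ 1 := by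
    rw [← hπ.2]; exact Finset.single_le_sum (fun y _ => hπ.1 y) (Finset.mem_univ i)
  have ht1 : (1 : ℝ) ≤ t := by exact_mod_cast ht
  have hc0 : 0 ≤ c := by
    rw [hc, sub_nonneg, div_le_one (by positivity)]
    nlinarith
  have hlin : ∀ y, skipSum s (n / s) (fun x z => 1 / 512 * φ x z) y
      = 1 / 512 * skipSum s (n / s) φ y := fun y => by
    simp only [skipSum, Finset.mul_sum]
  calc _ ≤ ∑ x : Fin (n + 1) → Ω, pathProb μ M x *
        Real.exp (skipSum s (n / s) (fun x z => 1 / 512 * φ x z) (extTraj x)) := by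
        refine Finset.sum_le_sum fun x _ => ?_
        rw [Set.indicator_apply]
        split_ifs with hx
        · refine le_mul_of_one_le_right (pathProb_nonneg hμ hM x) (Real.one_le_exp ?_)
          rw [hlin]
          exact mul_nonneg (by norm_num) hx
        · exact mul_nonneg (pathProb_nonneg hμ hM x) (Real.exp_nonneg _)
    _ = ∑ a, μ a * trajExp M (s * (n / s) + n % s) a fun y =>
          Real.exp (skipSum s (n / s) (fun x z => 1 / 512 * φ x z) y) := by
        rw [sum_pathProb_mul, Nat.div_add_mod]
        simp only [skipSum_extTraj (Nat.mul_div_le n s)]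
    _ ≤ ∑ a, μ a * (2 * c ^ (n / s)) := by
        refine Finset.sum_le_sum fun a _ => mul_le_mul_of_nonneg_left ?_ (hμ.1 a)
        refine (trajExp_exp_skipSum_le hM hc0 hv1 hv _ _ a).trans ?_
        rw [mul_comm 2]
        exact mul_le_mul_of_nonneg_left (hv2 a) (pow_nonneg hc0 _)
    _ = _ := by rw [← Finset.sum_mul, hμ.2, one_mul]

end PathLaw

section Estimator

/-- Number of transitions of the `s`-skipped trajectory from `i` into `A`. -/
noncomputable def hits (s K : ℕ) (i : Ω) (A : Finset Ω) (y : ℕ → Ω) : ℝ :=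
  skipSum s K (fun x z => if x = i then if z ∈ A then 1 else 0 else 0) y

/-- Empirical probability that the `s`-skipped trajectory jumps from `i` into `A`. -/
noncomputable def freq (s K : ℕ) (i : Ω) (A : Finset Ω) (y : ℕ → Ω) : ℝ :=
  hits s K i A y / hits s K i Finset.univ y

/-- The empirical `s`-step matrix is certified to be contracting. -/
def Accepts (n s : ℕ) (y : ℕ → Ω) : Prop :=
  ∀ i j (A : Finset Ω), freq s (n / s) i A y + freq s (n / s) j Aᶜ y < 1 + 5 / 32

/-- The first skipping rate whose empirical matrix is certified to be contracting. -/
noncomputable def mixEst {n : ℕ} (x : Fin (n + 1) → Ω) : ℕ :=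
  sInf {s | 0 < s ∧ Accepts n s (extTraj x)}

lemma hits_add_hits_compl (s K : ℕ) (i : Ω) (A : Finset Ω) (y : ℕ → Ω) :
    hits s K i A y + hits s K i Aᶜ y = hits s K i Finset.univ y := by
  simp only [hits, skipSum, ← Finset.sum_add_distrib]
  refine Finset.sum_congr rfl fun k _ => ?_
  by_cases h1 : y (s * k) = i <;> by_cases h2 : y (s * k + s) ∈ A <;> simp [h1, h2]

lemma skipSum_excess (s K : ℕ) (i : Ω) (A : Finset Ω) (q : ℝ) (y : ℕ → Ω) :
    skipSum s K (excess i A q) y = hits s K i A y - q * hits s K i Finset.univ y := by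
  simp only [hits, skipSum, Finset.mul_sum, ← Finset.sum_sub_distrib, excess]
  refine Finset.sum_congr rfl fun k _ => ?_
  by_cases h1 : y (s * k) = i <;> simp [h1]

/-- No empirical `s`-step transition frequency overshoots by `1 / 64` or more. -/
def Concentrated (M : Matrix Ω Ω ℝ) (n s : ℕ) (y : ℕ → Ω) : Prop :=
  ∀ i (A : Finset Ω), skipSum s (n / s) (excess i A (∑ z ∈ A, (M ^ s) i z + 1 / 64)) y < 0

lemma Concentrated.hits_pos {M : Matrix Ω Ω ℝ} {n s : ℕ} {y : ℕ → Ω} (h : Concentrated M n s y)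
    (i : Ω) : 0 < hits s (n / s) i Finset.univ y := by
  have := h i ∅
  rw [skipSum_excess] at this
  have h0 : hits s (n / s) i ∅ y = 0 := by simp [hits, skipSum]
  rw [h0, Finset.sum_empty] at this
  linarith

lemma Concentrated.freq_lt {M : Matrix Ω Ω ℝ} {n s : ℕ} {y : ℕ → Ω} (h : Concentrated M n s y)
    (i : Ω) (A : Finset Ω) : freq s (n / s) i A y < ∑ z ∈ A, (M ^ s) i z + 1 / 64 := by
  have := h i A
  rw [skipSum_excess] at this
  rw [freq, div_lt_iff₀ (h.hits_pos i)]
  linarith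

lemma Concentrated.freq_compl {M : Matrix Ω Ω ℝ} {n s : ℕ} {y : ℕ → Ω}
    (h : Concentrated M n s y) (i : Ω) (A : Finset Ω) :
    freq s (n / s) i A y + freq s (n / s) i Aᶜ y = 1 := by
  rw [freq, freq, ← add_div, hits_add_hits_compl, div_self (h.hits_pos i).ne']

lemma Concentrated.accepts {M : Matrix Ω Ω ℝ} (hM : IsStochastic M) {n s : ℕ} {y : ℕ → Ω}
    (h : Concentrated M n s y) (hosc : OscBound (M ^ s) (1 / 8)) : Accepts n s y := by
  intro i j A
  have h1 := h.freq_lt i A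
  have h2 := h.freq_lt j Aᶜ
  have h3 := hosc.sum_sub_sum_le A i j
  have h4 := Finset.sum_add_sum_compl A fun z => (M ^ s) j z
  rw [(hM.pow s).2] at h4
  linarith

lemma Concentrated.sum_sub_sum_le {M : Matrix Ω Ω ℝ} (hM : IsStochastic M) {n s : ℕ} {y : ℕ → Ω}
    (h : Concentrated M n s y) (ha : Accepts n s y) (A : Finset Ω) (i j : Ω) :
    ∑ z ∈ A, (M ^ s) i z - ∑ z ∈ A, (M ^ s) j z ≤ 3 / 16 := by
  have h1 := ha i j A
  have h2 := h.freq_compl i A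
  have h3 := h.freq_compl j A
  have h4 := h.freq_lt i Aᶜ
  have h5 := h.freq_lt j A
  have h6 := Finset.sum_add_sum_compl A fun z => (M ^ s) i z
  rw [(hM.pow s).2] at h6
  linarith

lemma mixEst_bounds {M : Matrix Ω Ω ℝ} {π : Ω → ℝ} (hM : IsStochastic M)
    (hE : IsErgodic M) (hπ : IsDist π) (hst : Matrix.vecMul π M = π) {n : ℕ}
    (x : Fin (n + 1) → Ω)
    (h : ∀ s ∈ Finset.Icc 1 (3 * mixTime M π (1 / 4)), Concentrated M n s (extTraj x)) :
    mixTime M π (1 / 4) ≤ mixEst x ∧ mixEst x ≤ 3 * mixTime M π (1 / 4) := by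
  obtain ⟨ht, hlt⟩ := mixTime_spec hM hE hπ hst (by norm_num : (0 : ℝ) < 1 / 4)
  set t := mixTime M π (1 / 4)
  have hosc : OscBound (M ^ t) (1 / 2) := fun f h0 h1 a b =>
    (oscBound_of_distToStat hM hπ f h0 h1 a b).trans (by linarith)
  have hosc3 : OscBound (M ^ (3 * t)) (1 / 8) := by
    have := hosc.pow_mul_add hM (by norm_num) 3 0
    rw [add_zero, mul_comm] at this
    norm_num at this ⊢
    exact this
  have hmem : 3 * t ∈ {s | 0 < s ∧ Accepts n s (extTraj x)} :=
    ⟨by omega, (h _ (Finset.mem_Icc.2 ⟨by omega, le_rfl⟩)).accepts hM hosc3⟩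
  have hle : mixEst x ≤ 3 * t := Nat.sInf_le hmem
  obtain ⟨h0, hacc⟩ : 0 < mixEst x ∧ Accepts n (mixEst x) (extTraj x) := Nat.sInf_mem ⟨_, hmem⟩
  refine ⟨mixTime_le h0 ?_, hle⟩
  refine (distToStat_le hM hπ hst
    ((h _ (Finset.mem_Icc.2 ⟨h0, hle⟩)).sum_sub_sum_le hM hacc)).trans_lt (by norm_num)

lemma one_sub_le_prTraj_mixEst {M : Matrix Ω Ω ℝ} {μ π : Ω → ℝ} (hM : IsStochastic M)
    (hE : IsErgodic M) (hμ : IsDist μ) (hπ : IsDist π) (hst : Matrix.vecMul π M = π) (n : ℕ)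
    {B : ℝ} (hB : ∀ s ∈ Finset.Icc 1 (3 * mixTime M π (1 / 4)), ∀ i,
      2 * (1 - π i / (2 ^ 22 * mixTime M π (1 / 4))) ^ (n / s) ≤ B) :
    1 - 3 * mixTime M π (1 / 4) * (Fintype.card Ω * (2 ^ Fintype.card Ω * B)) ≤
      prTraj μ M (n + 1) {x | mixTime M π (1 / 4) ≤ mixEst x ∧
        mixEst x ≤ 3 * mixTime M π (1 / 4)} := by
  classical
  obtain ⟨ht, hlt⟩ := mixTime_spec hM hE hπ hst (by norm_num : (0 : ℝ) < 1 / 4)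
  have hgood := mixEst_bounds hM hE hπ hst (n := n)
  set t := mixTime M π (1 / 4)
  have hosc : OscBound (M ^ t) (1 / 2) := fun f h0 h1 a b =>
    (oscBound_of_distToStat hM hπ f h0 h1 a b).trans (by linarith)
  set bad : ℕ → Ω → Finset Ω → Set (Fin (n + 1) → Ω) := fun s i A =>
    {x | 0 ≤ skipSum s (n / s) (excess i A (∑ y ∈ A, (M ^ s) i y + 1 / 64)) (extTraj x)} with hbad
  set E := {x : Fin (n + 1) → Ω | t ≤ mixEst x ∧ mixEst x ≤ 3 * t}
  have hnn : ∀ (S : Set (Fin (n + 1) → Ω)) x, 0 ≤ S.indicator (pathProb μ M) x :=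
    fun S x => Set.indicator_nonneg (fun x _ => pathProb_nonneg hμ hM x) x
  have hunion : ∀ x, pathProb μ M x ≤ E.indicator (pathProb μ M) x +
      ∑ s ∈ Finset.Icc 1 (3 * t), ∑ i, ∑ A, (bad s i A).indicator (pathProb μ M) x := by
    intro x
    by_cases hx : ∀ s ∈ Finset.Icc 1 (3 * t), Concentrated M n s (extTraj x)
    · have hxE : x ∈ E := hgood x hx
      rw [Set.indicator_of_mem hxE]
      exact le_add_of_nonneg_right (Finset.sum_nonneg fun s _ => Finset.sum_nonneg fun i _ =>
        Finset.sum_nonneg fun A _ => hnn _ x)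
    · simp only [Concentrated, not_forall, not_lt] at hx
      obtain ⟨s, hs, i, A, hx⟩ := hx
      have hxb : x ∈ bad s i A := hx
      refine le_add_of_nonneg_of_le (hnn _ x) ?_
      rw [← Set.indicator_of_mem hxb (pathProb μ M)]
      refine le_trans ?_ (Finset.single_le_sum (f := fun s => ∑ i, ∑ A,
        (bad s i A).indicator (pathProb μ M) x) (fun s _ => Finset.sum_nonneg fun i _ =>
        Finset.sum_nonneg fun A _ => hnn _ x) hs)
      refine le_trans ?_ (Finset.single_le_sum (f := fun i => ∑ A,
        (bad s i A).indicator (pathProb μ M) x) (fun i _ =>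
        Finset.sum_nonneg fun A _ => hnn _ x) (Finset.mem_univ i))
      exact Finset.single_le_sum (f := fun A => (bad s i A).indicator (pathProb μ M) x)
        (fun A _ => hnn _ x) (Finset.mem_univ A)
  have hsum := Finset.sum_le_sum fun x (_ : x ∈ Finset.univ) => hunion x
  rw [sum_pathProb hμ hM, Finset.sum_add_distrib] at hsum
  have hbadsum : ∑ x, ∑ s ∈ Finset.Icc 1 (3 * t), ∑ i, ∑ A,
      (bad s i A).indicator (pathProb μ M) x
      = ∑ s ∈ Finset.Icc 1 (3 * t), ∑ i, ∑ A, prTraj μ M (n + 1) (bad s i A) := by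
    rw [Finset.sum_comm]
    refine Finset.sum_congr rfl fun s _ => ?_
    rw [Finset.sum_comm]
    refine Finset.sum_congr rfl fun i _ => ?_
    rw [Finset.sum_comm]
    rfl
  have hbound : ∑ s ∈ Finset.Icc 1 (3 * t), ∑ i, ∑ A, prTraj μ M (n + 1) (bad s i A)
      ≤ ∑ s ∈ Finset.Icc 1 (3 * t), ∑ _i : Ω, ∑ _A : Finset Ω, B := by
    refine Finset.sum_le_sum fun s hs => Finset.sum_le_sum fun i _ =>
      Finset.sum_le_sum fun A _ => ?_
    exact (prTraj_excess_le hM hμ hπ hst ht (Finset.mem_Icc.1 hs).1 hosc (hE.pos hπ hst i)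
      A n).trans (hB s hs i)
  simp only [Finset.sum_const, Finset.card_univ, Fintype.card_finset, nsmul_eq_mul,
    Nat.card_Icc, Nat.add_sub_cancel, Nat.cast_mul, Nat.cast_pow, Nat.cast_ofNat] at hbound
  rw [hbadsum] at hsum
  change 1 ≤ prTraj μ M (n + 1) E + _ at hsum
  linarith

end Estimator

section SampleSize

lemma quarter_le_log_log {R : ℝ} (hR : 4 ≤ R) : 1 / 4 ≤ Real.log (Real.log R) := by
  have h4 : (4 / 3 : ℝ) ≤ Real.log R := by
    have h : Real.log 4 = 2 * Real.log 2 := by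
      rw [show (4 : ℝ) = 2 ^ 2 by norm_num, Real.log_pow]; norm_num
    have := Real.log_le_log (by norm_num) hR
    linarith [Real.log_two_gt_d9]
  have h1 := Real.one_sub_inv_le_log_of_pos (by linarith : (0 : ℝ) < Real.log R)
  have h2 : (Real.log R)⁻¹ ≤ (4 / 3 : ℝ)⁻¹ := inv_anti₀ (by norm_num) h4
  linarith

lemma sample_size_spec {δ p N : ℝ} {d t : ℕ} (hδ : δ ∈ Set.Ioo (0 : ℝ) 1) (hd : 2 ≤ d)
    (ht : 0 < t) (hp : 0 < p) (hpd : p * d ≤ 1)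
    (hN : N ≥ 2 ^ 29 * (1 * Real.log (t * d / (δ * p)) *
      Real.log (Real.log (t * d / (δ * p)))) * d * t ^ 2 / p) :
    4 ≤ t * d / (δ * p) ∧ 1 ≤ Real.log (t * d / (δ * p)) ∧
      2 ^ 27 * (Real.log (t * d / (δ * p)) * d * t ^ 2 / p) ≤ N := by
  obtain ⟨hδ0, hδ1⟩ := hδ
  have ht1 : (1 : ℝ) ≤ t := by exact_mod_cast ht
  have hd2 : (2 : ℝ) ≤ d := by exact_mod_cast hd
  have hp2 : p ≤ 1 / 2 := by nlinarith
  set R := t * d / (δ * p) with hR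
  have hR4 : 4 ≤ R := by
    rw [hR, le_div_iff₀ (mul_pos hδ0 hp)]
    have : δ * p ≤ 1 / 2 := by nlinarith
    nlinarith
  have hLL := quarter_le_log_log hR4
  have hL1 : 1 ≤ Real.log R := by
    rw [Real.le_log_iff_exp_le (by linarith)]
    linarith [Real.exp_one_lt_d9]
  refine ⟨hR4, hL1, ?_⟩
  set L := Real.log R
  have h1 : L * d * t ^ 2 / p * (1 / 4) ≤ L * d * t ^ 2 / p * Real.log L :=
    mul_le_mul_of_nonneg_left hLL (by positivity)
  have h2 : 2 ^ 29 * (1 * L * Real.log L) * d * t ^ 2 / p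
      = 2 ^ 29 * (L * d * t ^ 2 / p * Real.log L) := by ring
  rw [h2] at hN
  linarith

lemma union_bound_le {δ p : ℝ} {d t n s : ℕ} (hδ : δ ∈ Set.Ioo (0 : ℝ) 1) (hd : 2 ≤ d)
    (ht : 0 < t) (hp : 0 < p) (hpd : p * d ≤ 1) (hs : s ∈ Finset.Icc 1 (3 * t))
    (hn : ((n + 1 : ℕ) : ℝ) ≥ 2 ^ 29 * (1 * Real.log (t * d / (δ * p)) *
      Real.log (Real.log (t * d / (δ * p)))) * d * t ^ 2 / p) :
    2 * (1 - p / (2 ^ 22 * t)) ^ (n / s) ≤ δ / (3 * t * (d * 2 ^ d)) := by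
  obtain ⟨hR4, hL1, hn2⟩ := sample_size_spec hδ hd ht hp hpd hn
  obtain ⟨hδ0, hδ1⟩ := hδ
  obtain ⟨hs1, hs2⟩ := Finset.mem_Icc.1 hs
  have ht1 : (1 : ℝ) ≤ t := by exact_mod_cast ht
  have hd2 : (2 : ℝ) ≤ d := by exact_mod_cast hd
  have hp2 : p ≤ 1 / 2 := by nlinarith
  set R := t * d / (δ * p) with hR
  have hδR : t * d ≤ δ * R := by
    have : δ * R = t * d / p := by rw [hR]; field_simp
    rw [this, le_div_iff₀ hp]
    nlinarith [mul_pos (by linarith : (0 : ℝ) < t) (by linarith : (0 : ℝ) < d)]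
  set L := Real.log R with hL
  push_cast at hn2
  have hbig : (t : ℝ) ^ 2 ≤ L * d * t ^ 2 / p := by
    rw [le_div_iff₀ hp]
    have h1 : 1 ≤ L * d := by nlinarith
    have h2 : (0 : ℝ) ≤ t ^ 2 := by positivity
    nlinarith
  have hK : (n + 1 : ℝ) ≤ 6 * t * (n / s : ℕ) := by
    have h1 : n < s * (n / s) + s := by
      have := Nat.div_add_mod n s
      have := Nat.mod_lt n hs1
      omega
    have h2 : s * (n / s) + s ≤ 3 * t * (n / s) + 3 * t := by gcongr
    have h3 : ((n + 1 : ℕ) : ℝ) ≤ ((3 * t * (n / s) + 3 * t : ℕ) : ℝ) := by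
      exact_mod_cast (by omega)
    push_cast at h3 ⊢
    nlinarith
  set K := n / s
  have hexp : 3 * d * L ≤ p / (2 ^ 22 * t) * K := by
    have h1 : 2 ^ 27 * (L * d * t ^ 2 / p) ≤ 6 * t * K := hn2.trans hK
    have h2 : 2 ^ 27 * (L * d * t ^ 2 / p) * p = 2 ^ 27 * (L * d * t ^ 2) := by field_simp
    have h3 : 2 ^ 27 * (L * d * t ^ 2) ≤ 6 * t * K * p := by
      rw [← h2]; exact mul_le_mul_of_nonneg_right h1 hp.le
    have h4 : 2 ^ 27 * (L * d * t) ≤ 6 * K * p := by nlinarith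
    rw [div_mul_eq_mul_div, le_div_iff₀ (by positivity)]
    nlinarith
  have hpow : (1 - p / (2 ^ 22 * t)) ^ K ≤ Real.exp (-(3 * d * L)) := by
    have h1 : p / (2 ^ 22 * t) ≤ 1 := by
      rw [div_le_one (by positivity)]; nlinarith
    calc (1 - p / (2 ^ 22 * t)) ^ K ≤ Real.exp (-(p / (2 ^ 22 * t))) ^ K := by
          refine pow_le_pow_left₀ (by linarith) ?_ K
          linarith [Real.add_one_le_exp (-(p / (2 ^ 22 * t)))]
      _ = Real.exp (-(p / (2 ^ 22 * t) * K)) := by rw [← Real.exp_nat_mul]; ring_nf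
      _ ≤ _ := Real.exp_le_exp.2 (by linarith)
  have hexpR : Real.exp (3 * d * L) = R ^ (3 * d) := by
    rw [hL, show (3 * d * Real.log R : ℝ) = ((3 * d : ℕ) : ℝ) * Real.log R by push_cast; ring,
      Real.exp_nat_mul, Real.exp_log (by linarith)]
  have hRpow : 6 * 2 ^ d ≤ R ^ (3 * d - 1) := by
    calc (6 * 2 ^ d : ℝ) ≤ 4 ^ 2 * 4 ^ d := by
          have : (2 : ℝ) ^ d ≤ 4 ^ d := pow_le_pow_left₀ (by norm_num) (by norm_num) d
          have : (0 : ℝ) ≤ 2 ^ d := by positivity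
          linarith
      _ = 4 ^ (2 + d) := by rw [pow_add]
      _ ≤ 4 ^ (3 * d - 1) := pow_le_pow_right₀ (by norm_num) (by omega)
      _ ≤ R ^ (3 * d - 1) := pow_le_pow_left₀ (by norm_num) hR4 _
  have hfin : t * d * (6 * 2 ^ d) ≤ δ * R ^ (3 * d) := by
    rw [show R ^ (3 * d) = R * R ^ (3 * d - 1) by rw [← pow_succ']; congr 1; omega, ← mul_assoc δ]
    exact mul_le_mul hδR hRpow (by positivity) (by positivity)
  rw [le_div_iff₀ (by positivity)]
  have hE0 : 0 < R ^ (3 * d) := by positivity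
  calc 2 * (1 - p / (2 ^ 22 * t)) ^ K * (3 * t * (d * 2 ^ d))
      ≤ 2 * Real.exp (-(3 * d * L)) * (3 * t * (d * 2 ^ d)) := by gcongr
    _ = t * d * (6 * 2 ^ d) / R ^ (3 * d) := by
        rw [Real.exp_neg, hexpR]; field_simp; norm_num
    _ ≤ δ := by rw [div_le_iff₀ hE0]; exact hfin

end SampleSize

lemma piMinOf_mul_card_le {π : Ω → ℝ} (hπ : IsDist π) : piMinOf π * Fintype.card Ω ≤ 1 := by
  rw [← hπ.2, mul_comm, ← nsmul_eq_mul]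
  exact Finset.card_nsmul_le_sum _ _ _ fun i hi => Finset.inf'_le _ hi

/-- point estimator for the mixing time up to a factor of 3
(Corollary 5 of the paper). -/
theorem point_estimator_mixTime :
    ∃ c : ℝ, 0 < c ∧ ∃ c' : ℝ, 0 < c' ∧
      ∀ (δ : ℝ), δ ∈ Set.Ioo (0 : ℝ) 1 →
      ∀ (d : ℕ) (Ω : Type) [Fintype Ω] [DecidableEq Ω] [Nonempty Ω],
        Fintype.card Ω = d →
        ∀ m : ℕ, ∃ tmixhat : (Fin m → Ω) → ℝ,
          ∀ (M : Matrix Ω Ω ℝ) (μ π : Ω → ℝ),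
            IsStochastic M → IsErgodic M → IsDist μ → IsDist π →
            Matrix.vecMul π M = π →
            (m : ℝ) ≥ c * (c' * Real.log ((mixTime M π (1 / 4) : ℝ) * (d : ℝ) / (δ * piMinOf π)) *
                Real.log (Real.log ((mixTime M π (1 / 4) : ℝ) * (d : ℝ) / (δ * piMinOf π)))) *
                (d : ℝ) * (mixTime M π (1 / 4) : ℝ) ^ 2 / piMinOf π →
            1 - δ ≤ prTraj μ M m {x |
              (1 / 3 : ℝ) * (mixTime M π (1 / 4) : ℝ) ≤ tmixhat x ∧
                tmixhat x ≤ 3 * (mixTime M π (1 / 4) : ℝ)} := by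
  refine ⟨2 ^ 29, by norm_num, 1, one_pos, ?_⟩
  intro δ hδ d Ω _ _ _ hd m
  have hd1 : 0 < d := hd ▸ Fintype.card_pos
  rcases (Nat.succ_le_of_lt hd1).eq_or_lt with hone | htwo
  · refine ⟨fun _ => 1, fun M μ π hM hE hμ hπ hst _ => ?_⟩
    have : Subsingleton Ω := Fintype.card_le_one_iff_subsingleton.1 (by omega)
    have hle : distToStat M π 1 ≤ 0 := distToStat_le hM hπ hst fun A i j => by
      rw [Subsingleton.elim i j, sub_self]
    have ht : mixTime M π (1 / 4) = 1 := le_antisymm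
      (mixTime_le one_pos (hle.trans_lt (by norm_num)))
      (mixTime_spec hM hE hπ hst (by norm_num)).1
    have huniv : {x : Fin m → Ω | (1 / 3 : ℝ) * (mixTime M π (1 / 4) : ℝ) ≤ 1 ∧
        (1 : ℝ) ≤ 3 * (mixTime M π (1 / 4) : ℝ)} = Set.univ := by
      rw [ht]
      norm_num
    rw [huniv, prTraj, Set.indicator_univ, sum_pathProb hμ hM]
    linarith [hδ.1]
  have hpos : ∀ (M : Matrix Ω Ω ℝ) (π : Ω → ℝ), IsErgodic M → IsDist π →
      Matrix.vecMul π M = π → 0 < piMinOf π := fun M π hE hπ hst =>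
    (Finset.lt_inf'_iff _).2 fun i _ => hE.pos hπ hst i
  cases m with
  | zero =>
    refine ⟨fun _ => 0, fun M μ π hM hE hμ hπ hst hm => ?_⟩
    have ht := (mixTime_spec hM hE hπ hst (by norm_num : (0 : ℝ) < 1 / 4)).1
    have hpd := piMinOf_mul_card_le hπ
    rw [hd] at hpd
    have hp := hpos M π hE hπ hst
    obtain ⟨-, hL, hle⟩ := sample_size_spec hδ htwo ht hp hpd hm
    rw [Nat.cast_zero] at hle
    exact absurd hle (not_le.2 (by positivity))
  | succ n =>
    refine ⟨fun x => mixEst x, fun M μ π hM hE hμ hπ hst hm => ?_⟩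
    have ht := (mixTime_spec hM hE hπ hst (by norm_num : (0 : ℝ) < 1 / 4)).1
    have ht1 : (1 : ℝ) ≤ mixTime M π (1 / 4) := by exact_mod_cast ht
    have hpd := piMinOf_mul_card_le hπ
    rw [hd] at hpd
    have hp := hpos M π hE hπ hst
    have hB : ∀ s ∈ Finset.Icc 1 (3 * mixTime M π (1 / 4)), ∀ i,
        2 * (1 - π i / (2 ^ 22 * mixTime M π (1 / 4))) ^ (n / s) ≤
          δ / (3 * mixTime M π (1 / 4) * (d * 2 ^ d)) := by
      intro s hs i
      refine le_trans ?_ (union_bound_le hδ htwo ht hp hpd hs hm)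
      have hπ1 : π i ≤ 1 := by
        rw [← hπ.2]; exact Finset.single_le_sum (fun y _ => hπ.1 y) (Finset.mem_univ i)
      have hpi : piMinOf π ≤ π i := Finset.inf'_le _ (Finset.mem_univ i)
      have h1 : π i / (2 ^ 22 * mixTime M π (1 / 4)) ≤ 1 := by
        rw [div_le_one (by positivity)]; linarith
      gcongr
    have key := one_sub_le_prTraj_mixEst hM hE hμ hπ hst n hB
    rw [hd] at key
    have hδeq : 3 * (mixTime M π (1 / 4) : ℝ) * (d * (2 ^ d *
        (δ / (3 * mixTime M π (1 / 4) * (d * 2 ^ d))))) = δ := by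
      field_simp
    rw [hδeq] at key
    refine key.trans (Finset.sum_le_sum fun x _ => ?_)
    refine Set.indicator_le_indicator_of_subset (fun x hx => ?_)
      (fun x => pathProb_nonneg hμ hM x) x
    have h1 : (mixTime M π (1 / 4) : ℝ) ≤ mixEst x := by exact_mod_cast hx.1
    have h2 : (mixEst x : ℝ) ≤ 3 * mixTime M π (1 / 4) := by exact_mod_cast hx.2
    exact ⟨by linarith, h2⟩
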